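/- Let α, β ∈ [-1/2, 1/2], set ρ_α = α/2 + 1/4 and ρ_β = β/2 + 1/4, and for each n ≥ 1 let P_n^{(α,β),monic} be the monic Jacobi polynomial of degree n. Then the sequence a_n := 2^n · sup_{x ∈ [-1,1]} (1-x)^{ρ_α} (1+x)^{ρ_β} |P_n^{(α,β),monic}(x)| satisfies lim_{n→∞} a_n = sup_{n ≥ 1} a_n = 2^{1-ρ_α-ρ_β}; in particular the convergence of a_n to its limit is from below. -/

import Mathlib

open MeasureTheory Filter

/-- The weighted sup `sup_{x ∈ [-1,1]} (1-x)^ρα (1+x)^ρβ |P(x)|`. -/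
noncomputable def jacobiSup (ρa ρb : ℝ) (P : Polynomial ℝ) : ℝ :=
  sSup ((fun x : ℝ => (1 - x) ^ ρa * (1 + x) ^ ρb * |P.eval x|) '' Set.Icc (-1 : ℝ) 1)

/-- `P` is the monic Jacobi polynomial of degree `n` with parameters `α, β`. -/
def IsMonicJacobi (α β : ℝ) (n : ℕ) (P : Polynomial ℝ) : Prop :=
  P.Monic ∧ P.natDegree = n ∧
    ∀ k : ℕ, k < n →
      ∫ x in (-1 : ℝ)..1, (1 - x) ^ α * (1 + x) ^ β * P.eval x * x ^ k = 0

open Polynomial in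
/-- The integral of a polynomial against the Jacobi weight `(1 - x) ^ α * (1 + x) ^ β`. -/
noncomputable def jacobiInt (α β : ℝ) (q : ℝ[X]) : ℝ :=
  ∫ x in (-1 : ℝ)..1, (1 - x) ^ α * (1 + x) ^ β * q.eval x

section JacobiInt

open Polynomial

variable {α β : ℝ}

theorem intervalIntegrable_jacobiWeight (hα : -1 < α) (hβ : -1 < β) :
    IntervalIntegrable (fun x : ℝ => (1 - x) ^ α * (1 + x) ^ β) volume (-1) 1 := by
  have hl : IntervalIntegrable (fun x : ℝ => (1 + x) ^ β) volume (-1) 0 := by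
    have := (intervalIntegral.intervalIntegrable_rpow' (a := 0) (b := 1) hβ).comp_add_left 1
    simpa using this
  have hr : IntervalIntegrable (fun x : ℝ => (1 - x) ^ α) volume 0 1 := by
    have := (intervalIntegral.intervalIntegrable_rpow' (a := 0) (b := 1) hα).comp_sub_left 1
    simpa using this.symm
  refine IntervalIntegrable.trans (b := 0) (hl.continuousOn_mul ?_) (hr.mul_continuousOn ?_)
  · intro x hx
    rw [Set.uIcc_of_le (by norm_num)] at hx
    exact ((continuousAt_const.sub continuousAt_id).rpow_const
      (Or.inl (by simp only [Pi.sub_apply, id]; linarith [hx.2]))).continuousWithinAt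
  · intro x hx
    rw [Set.uIcc_of_le (by norm_num)] at hx
    exact ((continuousAt_const.add continuousAt_id).rpow_const
      (Or.inl (by simp only [Pi.add_apply, id]; linarith [hx.1]))).continuousWithinAt

theorem intervalIntegrable_jacobiWeight_mul (hα : -1 < α) (hβ : -1 < β) (q : ℝ[X]) :
    IntervalIntegrable (fun x : ℝ => (1 - x) ^ α * (1 + x) ^ β * q.eval x) volume (-1) 1 :=
  (intervalIntegrable_jacobiWeight hα hβ).mul_continuousOn q.continuous.continuousOn

theorem jacobiInt_add (hα : -1 < α) (hβ : -1 < β) (p q : ℝ[X]) :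
    jacobiInt α β (p + q) = jacobiInt α β p + jacobiInt α β q := by
  simp only [jacobiInt, eval_add, mul_add]
  exact intervalIntegral.integral_add (intervalIntegrable_jacobiWeight_mul hα hβ p)
    (intervalIntegrable_jacobiWeight_mul hα hβ q)

theorem jacobiInt_C_mul (c : ℝ) (q : ℝ[X]) :
    jacobiInt α β (C c * q) = c * jacobiInt α β q := by
  simp only [jacobiInt, eval_mul, eval_C]
  rw [← intervalIntegral.integral_const_mul]
  congr 1; ext x; ring

theorem jacobiInt_sum (hα : -1 < α) (hβ : -1 < β) {ι : Type*} (s : Finset ι) (f : ι → ℝ[X]) :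
    jacobiInt α β (∑ i ∈ s, f i) = ∑ i ∈ s, jacobiInt α β (f i) := by
  classical
  induction s using Finset.induction_on with
  | empty => simp [jacobiInt]
  | insert a s ha ih => rw [Finset.sum_insert ha, Finset.sum_insert ha, jacobiInt_add hα hβ, ih]

/-- A polynomial whose square has zero integral against the Jacobi weight vanishes. -/
theorem eq_zero_of_jacobiInt_mul_self (hα : -1 < α) (hβ : -1 < β) {q : ℝ[X]}
    (h : jacobiInt α β (q * q) = 0) : q = 0 := by
  by_contra hq
  have hnn : ∀ x ∈ Set.Ioo (-1 : ℝ) 1, 0 < (1 - x) ^ α * (1 + x) ^ β := fun x hx =>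
    mul_pos (Real.rpow_pos_of_pos (by linarith [hx.2]) _)
      (Real.rpow_pos_of_pos (by linarith [hx.1]) _)
  have hpos : 0 < jacobiInt α β (q * q) := by
    refine (intervalIntegral.integral_pos_iff_support_of_nonneg_ae' ?_
      (intervalIntegrable_jacobiWeight_mul hα hβ (q * q))).2 ⟨by norm_num, ?_⟩
    · rw [Set.uIoc_of_le (by norm_num)]
      filter_upwards [ae_restrict_mem measurableSet_Ioc] with x hx
      simp only [Pi.zero_apply, eval_mul]
      exact mul_nonneg (mul_nonneg (Real.rpow_nonneg (by linarith [hx.2]) _)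
        (Real.rpow_nonneg (by linarith [hx.1]) _)) (mul_self_nonneg _)
    · have hsub : Set.Ioo (-1 : ℝ) 1 \ (q.roots.toFinset : Set ℝ) ⊆
          Function.support (fun x : ℝ => (1 - x) ^ α * (1 + x) ^ β * (q * q).eval x) ∩
            Set.Ioc (-1) 1 := by
        rintro x ⟨hx, hxr⟩
        refine ⟨?_, hx.1, hx.2.le⟩
        have hx0 : q.eval x ≠ 0 := by
          intro h0
          apply hxr
          simp [hq, h0]
        simp only [Function.mem_support, eval_mul]
        exact mul_ne_zero (hnn x hx).ne' (mul_ne_zero hx0 hx0)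
      refine lt_of_lt_of_le ?_ (measure_mono hsub)
      rw [measure_sdiff_null (Finset.measure_zero _ _)]
      simp
  exact hpos.ne' h

/-- Integration by parts: the integral of the derivative of
`(1 - x) ^ (α + 1) * (1 + x) ^ (β + 1) * q x` vanishes. -/
theorem jacobiInt_pearson (hα : -1 < α) (hβ : -1 < β) (q : ℝ[X]) :
    jacobiInt α β ((C (β - α) - C (α + β + 2) * X) * q + (1 - X ^ 2) * derivative q) = 0 := by
  have h := intervalIntegral.integral_eq_sub_of_hasDerivAt_of_le (a := (-1 : ℝ)) (b := 1)
    (f := fun x : ℝ => (1 - x) ^ (α + 1) * (1 + x) ^ (β + 1) * q.eval x)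
    (f' := fun x : ℝ => (1 - x) ^ α * (1 + x) ^ β *
      ((C (β - α) - C (α + β + 2) * X) * q + (1 - X ^ 2) * derivative q).eval x)
    (by norm_num) ?_ ?_ (intervalIntegrable_jacobiWeight_mul hα hβ _)
  · rw [jacobiInt, h]
    simp [Real.zero_rpow (show α + 1 ≠ 0 by linarith), Real.zero_rpow (show β + 1 ≠ 0 by linarith)]
  · refine ContinuousOn.mul (ContinuousOn.mul ?_ ?_) q.continuous.continuousOn
    · exact (continuous_const.sub continuous_id).continuousOn.rpow_const
        fun _ _ => Or.inr (by linarith)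
    · exact (continuous_const.add continuous_id).continuousOn.rpow_const
        fun _ _ => Or.inr (by linarith)
  · intro x hx
    have h1 : 0 < 1 - x := by linarith [hx.2]
    have h2 : 0 < 1 + x := by linarith [hx.1]
    have d1 : HasDerivAt (fun x : ℝ => (1 - x) ^ (α + 1)) (-(α + 1) * (1 - x) ^ α) x := by
      have := ((hasDerivAt_id x).const_sub 1).rpow_const (p := α + 1) (Or.inl h1.ne')
      simpa using this
    have d2 : HasDerivAt (fun x : ℝ => (1 + x) ^ (β + 1)) ((β + 1) * (1 + x) ^ β) x := by
      have := ((hasDerivAt_id x).const_add 1).rpow_const (p := β + 1) (Or.inl h2.ne')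
      simpa using this
    refine ((d1.mul d2).mul (q.hasDerivAt x)).congr_deriv ?_
    simp only [Pi.mul_apply, eval_add, eval_mul, eval_sub, eval_C, eval_X, eval_one, eval_pow]
    rw [Real.rpow_add_one h1.ne', Real.rpow_add_one h2.ne']
    ring

theorem jacobiInt_shift (q : ℝ[X]) :
    jacobiInt (α + 1) (β + 1) q = jacobiInt α β ((1 - X ^ 2) * q) := by
  simp only [jacobiInt]
  refine intervalIntegral.integral_congr_Ioo_of_le (by norm_num) fun x hx => ?_
  have h1 : 0 < 1 - x := by linarith [hx.2]
  have h2 : 0 < 1 + x := by linarith [hx.1]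
  simp only [eval_mul, eval_sub, eval_one, eval_pow, eval_X]
  rw [Real.rpow_add_one h1.ne', Real.rpow_add_one h2.ne']
  ring

end JacobiInt

section JacobiPolynomial

open Polynomial

variable {α β : ℝ}

/-- The Jacobi differential equation with spectral parameter `l`. -/
def IsJacobiSolution (α β l : ℝ) (p : ℝ[X]) : Prop :=
  (1 - X ^ 2) * derivative (derivative p) + (C (β - α) - C (α + β + 2) * X) * derivative p
    + C l * p = 0

theorem coeff_X_mul_derivative (p : ℝ[X]) (m : ℕ) :
    (X * derivative p).coeff m = m * p.coeff m := by
  cases m with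
  | zero => simp
  | succ m => rw [coeff_X_mul, coeff_derivative]; push_cast; ring

theorem coeff_X_sq_mul_derivative_derivative (p : ℝ[X]) (m : ℕ) :
    (X ^ 2 * derivative (derivative p)).coeff m = m * (m - 1) * p.coeff m := by
  rcases m with _ | _ | m
  · simp [pow_two, mul_assoc]
  · simp [pow_two, mul_assoc]
  · rw [coeff_X_pow_mul, coeff_derivative, coeff_derivative]; push_cast; ring

theorem coeff_jacobiOperator (a b l : ℝ) (p : ℝ[X]) (m : ℕ) :
    ((1 - X ^ 2) * derivative (derivative p) + (C a - C b * X) * derivative p + C l * p).coeff m =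
      (m + 2) * (m + 1) * p.coeff (m + 2) + a * (m + 1) * p.coeff (m + 1)
        + (l - m * (m - 1) - b * m) * p.coeff m := by
  have : (1 - X ^ 2) * derivative (derivative p) + (C a - C b * X) * derivative p + C l * p
      = derivative (derivative p) - X ^ 2 * derivative (derivative p) + C a * derivative p
        - C b * (X * derivative p) + C l * p := by ring
  rw [this]
  simp only [coeff_add, coeff_sub, coeff_C_mul, coeff_X_mul_derivative,
    coeff_X_sq_mul_derivative_derivative, coeff_derivative]
  push_cast
  ring

namespace IsMonicJacobi

variable {n : ℕ} {P : ℝ[X]}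

theorem jacobiInt_mul_eq_zero (hα : -1 < α) (hβ : -1 < β) (hP : IsMonicJacobi α β n P)
    {q : ℝ[X]} (hq : q.degree < n) : jacobiInt α β (P * q) = 0 := by
  rcases eq_or_ne q 0 with rfl | hq0
  · simp [jacobiInt]
  rw [as_sum_range_C_mul_X_pow' _ ((natDegree_lt_iff_degree_lt hq0).2 hq), Finset.mul_sum,
    jacobiInt_sum hα hβ]
  refine Finset.sum_eq_zero fun k hk => ?_
  have h := hP.2.2 k (Finset.mem_range.1 hk)
  rw [show P * (C (q.coeff k) * X ^ k) = C (q.coeff k) * (P * X ^ k) by ring, jacobiInt_C_mul]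
  have : jacobiInt α β (P * X ^ k) = 0 := by
    rw [← h, jacobiInt]
    simp only [eval_mul, eval_pow, eval_X, mul_assoc]
  rw [this, mul_zero]

theorem isJacobiSolution (hα : -1 < α) (hβ : -1 < β) (hP : IsMonicJacobi α β n P) :
    IsJacobiSolution α β (n * (n + α + β + 1)) P := by
  set R := (1 - X ^ 2) * derivative (derivative P)
    + (C (β - α) - C (α + β + 2) * X) * derivative P + C (n * (n + α + β + 1) : ℝ) * P with hR
  have hcoeff : ∀ m, n < m → P.coeff m = 0 := fun m hm =>
    coeff_eq_zero_of_natDegree_lt (hP.2.1.symm ▸ hm)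
  have hdeg : R.degree < n := by
    rw [degree_lt_iff_coeff_zero]
    intro m hm
    rw [hR, coeff_jacobiOperator, hcoeff (m + 2) (by omega), hcoeff (m + 1) (by omega)]
    rcases hm.eq_or_lt with rfl | hm
    · ring
    · rw [hcoeff m hm]; ring
  have key : ∀ q : ℝ[X], q.degree < n → jacobiInt α β (R * q) = 0 := by
    intro q hq
    have e1 := jacobiInt_pearson hα hβ (derivative P * q)
    have e2 := jacobiInt_pearson hα hβ (P * derivative q)
    have e3 : jacobiInt α β (P * ((1 - X ^ 2) * derivative (derivative q)
        + (C (β - α) - C (α + β + 2) * X) * derivative q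
        + C (n * (n + α + β + 1) : ℝ) * q)) = 0 := by
      refine hP.jacobiInt_mul_eq_zero hα hβ ?_
      rw [degree_lt_iff_coeff_zero] at hq ⊢
      intro m hm
      rw [coeff_jacobiOperator, hq m hm, hq (m + 1) (by omega), hq (m + 2) (by omega)]
      ring
    have e4 : R * q
        + ((C (β - α) - C (α + β + 2) * X) * (P * derivative q)
          + (1 - X ^ 2) * derivative (P * derivative q))
        = ((C (β - α) - C (α + β + 2) * X) * (derivative P * q)
          + (1 - X ^ 2) * derivative (derivative P * q))
        + P * ((1 - X ^ 2) * derivative (derivative q)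
        + (C (β - α) - C (α + β + 2) * X) * derivative q
        + C (n * (n + α + β + 1) : ℝ) * q) := by
      rw [hR, derivative_mul, derivative_mul]; ring
    have e5 := congrArg (jacobiInt α β) e4
    rw [jacobiInt_add hα hβ (R * q), e2, jacobiInt_add hα hβ, e1, e3] at e5
    linarith
  exact eq_zero_of_jacobiInt_mul_self hα hβ (key R hdeg)

/-- The derivative of a Jacobi polynomial is a Jacobi polynomial with shifted parameters. -/
theorem C_inv_mul_derivative (hα : -1 < α) (hβ : -1 < β) (hP : IsMonicJacobi α β (n + 1) P) :
    IsMonicJacobi (α + 1) (β + 1) n (C ((n + 1 : ℝ)⁻¹) * derivative P) := by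
  have hn : (n + 1 : ℝ) ≠ 0 := by positivity
  have hcn : (C ((n + 1 : ℝ)⁻¹) * derivative P).coeff n = 1 := by
    have h1 : P.coeff (n + 1) = 1 := by
      have := hP.1.coeff_natDegree
      rwa [hP.2.1] at this
    rw [coeff_C_mul, coeff_derivative, h1]
    field_simp
  have hle : (C ((n + 1 : ℝ)⁻¹) * derivative P).natDegree ≤ n := by
    refine (natDegree_C_mul_le _ _).trans ((natDegree_derivative_le P).trans ?_)
    rw [hP.2.1]; simp
  refine ⟨monic_of_natDegree_le_of_coeff_eq_one n hle hcn,
    le_antisymm hle (le_natDegree_of_ne_zero (by rw [hcn]; exact one_ne_zero)), fun k hk => ?_⟩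
  have e0 : jacobiInt (α + 1) (β + 1) (C ((n + 1 : ℝ)⁻¹) * (derivative P * X ^ k))
      = 0 := by
    rw [jacobiInt_C_mul, jacobiInt_shift]
    have e1 := jacobiInt_pearson hα hβ (P * X ^ k)
    have e2 : jacobiInt α β (P * ((1 - X ^ 2) * derivative (X ^ k)
        + (C (β - α) - C (α + β + 2) * X) * X ^ k)) = 0 := by
      refine hP.jacobiInt_mul_eq_zero hα hβ ?_
      have : (1 - X ^ 2 : ℝ[X]) * derivative (X ^ k)
        + (C (β - α) - C (α + β + 2) * X) * X ^ k
        = C (k : ℝ) * X ^ (k - 1) - C (α + β + 2 + k) * X ^ (k + 1) + C (β - α) * X ^ k := by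
        cases k with
        | zero => simp; ring
        | succ k => simp; ring
      rw [this, degree_lt_iff_coeff_zero]
      intro m hm
      simp only [coeff_add, coeff_sub, coeff_C_mul, coeff_X_pow]
      rw [if_neg (by omega), if_neg (by omega), if_neg (by omega)]
      ring
    have e3 : (C (β - α) - C (α + β + 2) * X) * (P * X ^ k)
          + (1 - X ^ 2) * derivative (P * X ^ k)
        = P * ((1 - X ^ 2) * derivative (X ^ k)
        + (C (β - α) - C (α + β + 2) * X) * X ^ k)
        + (1 - X ^ 2) * (derivative P * X ^ k) := by
      rw [derivative_mul]; ring
    rw [e3, jacobiInt_add hα hβ, e2] at e1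
    rw [zero_add] at e1
    rw [e1, mul_zero]
  rw [← e0, jacobiInt]
  simp only [eval_mul, eval_pow, eval_X, mul_assoc]

theorem jacobiInt_mul_self_succ (hα : -1 < α) (hβ : -1 < β) (hP : IsMonicJacobi α β (n + 1) P) :
    (n + α + β + 2) * jacobiInt α β (P * P) =
      (n + 1) * jacobiInt (α + 1) (β + 1) ((C ((n + 1 : ℝ)⁻¹) * derivative P) *
        (C ((n + 1 : ℝ)⁻¹) * derivative P)) := by
  have hn : (n + 1 : ℝ) ≠ 0 := by positivity
  have e1 := jacobiInt_pearson hα hβ (P * derivative P)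
  have hS := hP.isJacobiSolution hα hβ
  have e2 : C ((n + 1) * (n + α + β + 2)) * (P * P)
      + ((C (β - α) - C (α + β + 2) * X) * (P * derivative P)
        + (1 - X ^ 2) * derivative (P * derivative P))
      = (1 - X ^ 2) * (derivative P * derivative P) := by
    have hC : C ((n + 1 : ℕ) * ((n + 1 : ℕ) + α + β + 1) : ℝ)
        = C ((n + 1) * (n + α + β + 2) : ℝ) := by
      congr 1; push_cast; ring
    rw [IsJacobiSolution, hC] at hS
    rw [derivative_mul]
    linear_combination P * hS
  have e3 := congrArg (jacobiInt α β) e2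
  rw [jacobiInt_add hα hβ, e1, jacobiInt_C_mul, ← jacobiInt_shift] at e3
  rw [show (C ((n + 1 : ℝ)⁻¹) * derivative P) *
        (C ((n + 1 : ℝ)⁻¹) * derivative P) = C ((n + 1 : ℝ)⁻¹) * (C ((n + 1 : ℝ)⁻¹) *
        (derivative P * derivative P)) by ring, jacobiInt_C_mul,
    jacobiInt_C_mul, ← e3]
  field_simp
  ring

end IsMonicJacobi

end JacobiPolynomial

section JacobiNorm

open Polynomial

variable {α β : ℝ}

theorem integral_rpow_mul_one_sub_rpow {a b : ℝ} (ha : 0 < a) (hb : 0 < b) :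
    ∫ x in (0 : ℝ)..1, x ^ (a - 1) * (1 - x) ^ (b - 1) =
      Real.Gamma a * Real.Gamma b / Real.Gamma (a + b) := by
  have h := ProbabilityTheory.beta_eq_betaIntegralReal a b ha hb
  rw [ProbabilityTheory.beta] at h
  rw [h, Complex.betaIntegral, ← Complex.ofReal_re (∫ x in (0 : ℝ)..1, _),
    ← intervalIntegral.integral_ofReal]
  congr 1
  refine intervalIntegral.integral_congr_Ioo_of_le zero_le_one fun x hx => ?_
  rw [Complex.ofReal_mul, Complex.ofReal_cpow hx.1.le, Complex.ofReal_cpow (by linarith [hx.2])]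
  push_cast
  rfl

theorem jacobiInt_one (hα : -1 < α) (hβ : -1 < β) :
    jacobiInt α β 1 = 2 ^ (α + β + 1) *
      (Real.Gamma (α + 1) * Real.Gamma (β + 1) / Real.Gamma (α + β + 2)) := by
  have h := intervalIntegral.integral_comp_mul_sub (a := 0) (b := 1)
    (fun x : ℝ => (1 - x) ^ α * (1 + x) ^ β * (1 : ℝ[X]).eval x) (two_ne_zero' ℝ) 1
  have h2 := integral_rpow_mul_one_sub_rpow (a := β + 1) (b := α + 1) (by linarith) (by linarith)
  have h3 : ∫ x in (0 : ℝ)..1, (1 - (2 * x - 1)) ^ α * (1 + (2 * x - 1)) ^ β *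
        (1 : ℝ[X]).eval (2 * x - 1)
      = ∫ x in (0 : ℝ)..1, 2 ^ (α + β) * (x ^ (β + 1 - 1) * (1 - x) ^ (α + 1 - 1)) := by
    refine intervalIntegral.integral_congr_Ioo_of_le zero_le_one fun x hx => ?_
    have h1x : 0 ≤ 1 - x := by linarith [hx.2]
    simp only [eval_one]
    rw [show 1 - (2 * x - 1) = 2 * (1 - x) by ring, show 1 + (2 * x - 1) = 2 * x by ring,
      Real.mul_rpow zero_le_two h1x, Real.mul_rpow zero_le_two hx.1.le,
      Real.rpow_add zero_lt_two, add_sub_cancel_right, add_sub_cancel_right]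
    ring
  rw [h3, intervalIntegral.integral_const_mul, h2] at h
  norm_num at h
  rw [jacobiInt, Real.rpow_add_one two_ne_zero, show α + β + 2 = β + 1 + (α + 1) by ring]
  simp only [eval_one, mul_one]
  linear_combination (-2) * h

/-- The squared norm of the monic Jacobi polynomial of degree `n`. -/
noncomputable def jacobiNormSq (α β : ℝ) (n : ℕ) : ℝ :=
  2 ^ (2 * n + (α + β + 1)) *
    (Real.Gamma (n + 1) * Real.Gamma (n + (α + β + 1)) * Real.Gamma (n + (α + 1)) *
      Real.Gamma (n + (β + 1))) /
    (Real.Gamma (2 * n + (α + β + 1)) * Real.Gamma (2 * n + (α + β + 2)))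

theorem IsMonicJacobi.jacobiInt_mul_self {n : ℕ} {P : ℝ[X]} (hα : -1 < α) (hβ : -1 < β)
    (hs : 0 < n + (α + β + 1)) (hP : IsMonicJacobi α β n P) :
    jacobiInt α β (P * P) = jacobiNormSq α β n := by
  induction n generalizing α β P with
  | zero =>
    rw [hP.1.natDegree_eq_zero.1 hP.2.1, one_mul, jacobiInt_one hα hβ, jacobiNormSq]
    have := (Real.Gamma_pos_of_pos hs).ne'
    simp only [Nat.cast_zero, zero_add, mul_zero] at this ⊢
    rw [Real.Gamma_one]
    field_simp
  | succ n ih =>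
    have h := hP.jacobiInt_mul_self_succ hα hβ
    rw [ih (by linarith) (by linarith) (by push_cast at hs; linarith)
      (hP.C_inv_mul_derivative hα hβ)] at h
    have hs' : 0 < n + α + β + 2 := by push_cast at hs; linarith
    have e1 : Real.Gamma (n + (α + 1 + (β + 1) + 1))
        = (n + α + β + 2) * Real.Gamma (n + α + β + 2) := by
      rw [← Real.Gamma_add_one hs'.ne']; ring_nf
    have e2 : Real.Gamma ((n + 1 : ℕ) + 1) = (n + 1) * Real.Gamma (n + 1) := by
      push_cast; rw [Real.Gamma_add_one (by positivity)]
    refine mul_left_cancel₀ hs'.ne' (h.trans ?_)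
    rw [jacobiNormSq, jacobiNormSq, e1, e2]
    push_cast
    ring_nf

theorem tendsto_Gamma_add_div {x : ℝ} (hx : 0 ≤ x) :
    Tendsto (fun n : ℕ => Real.Gamma (n + x) / (Real.Gamma n * (n : ℝ) ^ x)) atTop (nhds 1) := by
  rcases hx.eq_or_lt with rfl | hx
  · refine tendsto_const_nhds.congr' ?_
    filter_upwards [eventually_gt_atTop 0] with n hn
    have := (Real.Gamma_pos_of_pos (Nat.cast_pos.2 hn : (0 : ℝ) < n)).ne'
    simp [this]
  have hprod : ∀ n : ℕ, ∏ j ∈ Finset.range n, (x + j) = Real.Gamma (n + x) / Real.Gamma x := by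
    intro n
    have h0 := (Real.Gamma_pos_of_pos hx).ne'
    induction n with
    | zero => simp [h0]
    | succ n ih =>
      rw [Finset.prod_range_succ, ih, Nat.cast_succ, add_right_comm,
        Real.Gamma_add_one (by positivity)]
      ring
  have h1 : Tendsto (fun n : ℕ => Real.Gamma x / Real.GammaSeq x n) atTop (nhds 1) := by
    have := (tendsto_const_nhds (x := Real.Gamma x)).div (Real.GammaSeq_tendsto_Gamma x)
      (Real.Gamma_pos_of_pos hx).ne'
    rwa [div_self (Real.Gamma_pos_of_pos hx).ne'] at this
  have h2 : Tendsto (fun n : ℕ => (n : ℝ) / (n + x)) atTop (nhds 1) :=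
    tendsto_natCast_div_add_atTop x
  have h3 := h1.mul h2
  rw [one_mul] at h3
  refine h3.congr' ?_
  filter_upwards [eventually_gt_atTop 0] with n hn
  have hn' : (0 : ℝ) < n := Nat.cast_pos.2 hn
  have g0 := (Real.Gamma_pos_of_pos hx).ne'
  have g1 := (Real.Gamma_pos_of_pos (by linarith : 0 < n + x)).ne'
  have g2 := (Real.Gamma_pos_of_pos hn').ne'
  have e : (n.factorial : ℝ) = n * Real.Gamma n := by
    rw [← Real.Gamma_nat_eq_factorial, Real.Gamma_add_one hn'.ne']
  have hp : (n : ℝ) ^ x ≠ 0 := (Real.rpow_pos_of_pos hn' x).ne'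
  have hnx : (n : ℝ) + x ≠ 0 := by positivity
  rw [Real.GammaSeq, hprod, Nat.cast_succ, add_right_comm, Real.Gamma_add_one hnx, e]
  field_simp

theorem tendsto_Gamma_sq_div_Gamma_two_mul :
    Tendsto (fun n : ℕ => Real.Gamma n ^ 4 / Real.Gamma (2 * n) ^ 2 * n * 16 ^ n) atTop
      (nhds (4 * Real.pi)) := by
  have h1 := Stirling.tendsto_stirlingSeq_sqrt_pi
  have h2 : Tendsto (fun n : ℕ => Stirling.stirlingSeq (2 * n)) atTop (nhds (√Real.pi)) :=
    h1.comp (tendsto_id.const_mul_atTop' (by norm_num))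
  have hpi : √Real.pi ≠ 0 := (Real.sqrt_pos.2 Real.pi_pos).ne'
  have h3 := (((h1.pow 2).div h2 hpi).pow 2).const_mul 4
  have e : (4 : ℝ) * ((√Real.pi ^ 2 / √Real.pi) ^ 2) = 4 * Real.pi := by
    rw [pow_two (√Real.pi), mul_div_cancel_right₀ _ hpi, Real.sq_sqrt Real.pi_pos.le]
  rw [e] at h3
  refine h3.congr' ?_
  filter_upwards [eventually_gt_atTop 0] with n hn
  have hn' : (0 : ℝ) < n := Nat.cast_pos.2 hn
  have e1 : (n.factorial : ℝ) = n * Real.Gamma n := by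
    rw [← Real.Gamma_nat_eq_factorial, Real.Gamma_add_one hn'.ne']
  have e2 : ((2 * n).factorial : ℝ) = 2 * n * Real.Gamma (2 * n) := by
    rw [← Real.Gamma_nat_eq_factorial, Real.Gamma_add_one (by positivity)]; push_cast; rfl
  have g1 := (Real.Gamma_pos_of_pos hn').ne'
  have g2 := (Real.Gamma_pos_of_pos (by positivity : (0 : ℝ) < 2 * n)).ne'
  have hexp := (Real.exp_pos 1).ne'
  simp only [Stirling.stirlingSeq, Pi.div_apply, e1, e2]
  push_cast
  have s1 : √(2 * (n : ℝ)) ^ 2 = 2 * n := Real.sq_sqrt (by positivity)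
  have s2 : √(2 * (2 * (n : ℝ))) ^ 2 = 4 * n := by rw [Real.sq_sqrt (by positivity)]; ring
  have hpw : ((2 * (n : ℝ) / Real.exp 1) ^ (2 * n)) ^ 2
      = 16 ^ n * (((n : ℝ) / Real.exp 1) ^ n) ^ 4 := by
    rw [mul_div_assoc, mul_pow, mul_pow, ← pow_mul, ← pow_mul, ← pow_mul,
      show 2 * n * 2 = 4 * n by ring, show n * 4 = 4 * n by ring, pow_mul]
    norm_num
  set y := ((n : ℝ) / Real.exp 1) ^ n with hy
  have hy0 : y ≠ 0 := pow_ne_zero _ (div_ne_zero hn'.ne' hexp)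
  set z := (2 * (n : ℝ) / Real.exp 1) ^ (2 * n) with hz
  have hz0 : z ≠ 0 := pow_ne_zero _ (div_ne_zero (by positivity) hexp)
  have hs1 : √(2 * (n : ℝ)) ≠ 0 := by positivity
  have hs2 : √(2 * (2 * (n : ℝ))) ≠ 0 := by positivity
  have : 4 * ((n * Real.Gamma n / (√(2 * n) * y)) ^ 2 /
      (2 * n * Real.Gamma (2 * n) / (√(2 * (2 * n)) * z))) ^ 2
      = 4 * (n * Real.Gamma n) ^ 4 * (√(2 * (2 * n)) ^ 2 * z ^ 2) /
        ((√(2 * n) ^ 2) ^ 2 * y ^ 4 * (2 * n * Real.Gamma (2 * n)) ^ 2) := by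
    field_simp
  rw [this, s1, s2, hpw]
  field_simp
  ring

theorem tendsto_four_pow_mul_jacobiNormSq (hα : -1 ≤ α) (hβ : -1 ≤ β) (hs : -1 ≤ α + β) :
    Tendsto (fun n : ℕ => 4 ^ n * jacobiNormSq α β n) atTop
      (nhds (Real.pi * 2 ^ (-(α + β)))) := by
  have two : Tendsto (fun n : ℕ => 2 * n) atTop atTop := tendsto_id.const_mul_atTop' (by norm_num)
  have t1 := tendsto_Gamma_add_div (zero_le_one)
  have t2 := tendsto_Gamma_add_div (x := α + β + 1) (by linarith)
  have t3 := tendsto_Gamma_add_div (x := α + 1) (by linarith)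
  have t4 := tendsto_Gamma_add_div (x := β + 1) (by linarith)
  have t5 := (tendsto_Gamma_add_div (x := α + β + 1) (by linarith)).comp two
  have t6 := (tendsto_Gamma_add_div (x := α + β + 2) (by linarith)).comp two
  have h := (((((t1.mul t2).mul t3).mul t4).div (t5.mul t6) (by norm_num)).mul
    tendsto_Gamma_sq_div_Gamma_two_mul).mul_const ((2 : ℝ) ^ (-(α + β) - 2))
  have e : (1 * 1 * 1 * 1 / (1 * 1) * (4 * Real.pi)) * (2 : ℝ) ^ (-(α + β) - 2)
      = Real.pi * 2 ^ (-(α + β)) := by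
    rw [Real.rpow_sub zero_lt_two]; norm_num; ring
  rw [e] at h
  refine h.congr' ?_
  filter_upwards [eventually_gt_atTop 0] with n hn
  have hn' : (0 : ℝ) < n := Nat.cast_pos.2 hn
  have g1 := (Real.Gamma_pos_of_pos hn').ne'
  have g2 := (Real.Gamma_pos_of_pos (by positivity : (0 : ℝ) < 2 * n)).ne'
  have g3 := (Real.Gamma_pos_of_pos (by linarith : (0 : ℝ) < 2 * n + (α + β + 1))).ne'
  have g4 := (Real.Gamma_pos_of_pos (by linarith : (0 : ℝ) < 2 * n + (α + β + 2))).ne'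
  simp only [Function.comp_apply, Pi.div_apply, jacobiNormSq]
  push_cast
  rw [Real.mul_rpow zero_le_two hn'.le, Real.mul_rpow zero_le_two hn'.le,
    show α + β + 2 = (α + β + 1) + 1 by ring, Real.rpow_one,
    Real.rpow_add_one hn'.ne', Real.rpow_add_one hn'.ne', Real.rpow_add_one hn'.ne',
    Real.rpow_add_one hn'.ne', Real.rpow_add_one hn'.ne', Real.rpow_add hn' α β,
    Real.rpow_add_one two_ne_zero,
    Real.rpow_add_one two_ne_zero, Real.rpow_add zero_lt_two (2 * (n : ℝ)),
    Real.rpow_add_one two_ne_zero,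
    Real.rpow_sub zero_lt_two, Real.rpow_neg zero_le_two,
    show (2 : ℝ) ^ (2 * (n : ℝ)) = 4 ^ n by
      rw [Real.rpow_mul zero_le_two, Real.rpow_natCast]; norm_num,
    show (16 : ℝ) ^ n = 4 ^ n * 4 ^ n by rw [← mul_pow]; norm_num]
  have r1 : (n : ℝ) ^ α ≠ 0 := (Real.rpow_pos_of_pos hn' _).ne'
  have r2 : (n : ℝ) ^ β ≠ 0 := (Real.rpow_pos_of_pos hn' _).ne'
  have r3 : (2 : ℝ) ^ (α + β) ≠ 0 := (Real.rpow_pos_of_pos zero_lt_two _).ne'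
  rw [show α + β + 2 = α + β + 1 + 1 by ring] at g4
  norm_num
  field_simp
  ring

theorem four_pow_mul_jacobiNormSq_le_succ (hα : α ∈ Set.Icc (-(1 : ℝ) / 2) (1 / 2))
    (hβ : β ∈ Set.Icc (-(1 : ℝ) / 2) (1 / 2)) {n : ℕ} (hn : 1 ≤ n) :
    4 ^ n * jacobiNormSq α β n ≤ 4 ^ (n + 1) * jacobiNormSq α β (n + 1) := by
  obtain ⟨a1, a2⟩ := hα
  obtain ⟨b1, b2⟩ := hβ
  have hn' : (1 : ℝ) ≤ n := by exact_mod_cast hn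
  have p1 : (0 : ℝ) < n + 1 := by linarith
  have p2 : (0 : ℝ) < n + (α + β + 1) := by linarith
  have p3 : (0 : ℝ) < n + (α + 1) := by linarith
  have p4 : (0 : ℝ) < n + (β + 1) := by linarith
  have p5 : (0 : ℝ) < 2 * n + (α + β + 1) := by linarith
  have p6 : (0 : ℝ) < 2 * n + (α + β + 2) := by linarith
  have p7 : (0 : ℝ) < 2 * n + (α + β + 3) := by linarith
  have ratio : 4 ^ (n + 1) * jacobiNormSq α β (n + 1) = 4 ^ n * jacobiNormSq α β n *
      (16 * (n + 1) * (n + (α + β + 1)) * (n + (α + 1)) * (n + (β + 1)) /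
        ((2 * n + (α + β + 1)) * (2 * n + (α + β + 2)) ^ 2 * (2 * n + (α + β + 3)))) := by
    have g5 := (Real.Gamma_pos_of_pos p5).ne'
    have g6 := (Real.Gamma_pos_of_pos p6).ne'
    simp only [jacobiNormSq]
    push_cast
    rw [show (n : ℝ) + 1 + (α + β + 1) = n + (α + β + 1) + 1 by ring,
      show (n : ℝ) + 1 + (α + 1) = n + (α + 1) + 1 by ring,
      show (n : ℝ) + 1 + (β + 1) = n + (β + 1) + 1 by ring,
      show 2 * ((n : ℝ) + 1) + (α + β + 1) = 2 * n + (α + β + 1) + 1 + 1 by ring,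
      show 2 * ((n : ℝ) + 1) + (α + β + 2) = 2 * n + (α + β + 2) + 1 + 1 by ring,
      Real.Gamma_add_one p1.ne', Real.Gamma_add_one p2.ne', Real.Gamma_add_one p3.ne',
      Real.Gamma_add_one p4.ne', Real.Gamma_add_one (by linarith : 2 * n + (α + β + 1) + 1 ≠ 0),
      Real.Gamma_add_one (by linarith : 2 * n + (α + β + 2) + 1 ≠ 0),
      Real.Gamma_add_one p5.ne', Real.Gamma_add_one p6.ne', Real.rpow_add_one two_ne_zero,
      Real.rpow_add_one two_ne_zero,
      show 2 * (n : ℝ) + (α + β + 1) + 1 = 2 * n + (α + β + 2) by ring,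
      show 2 * (n : ℝ) + (α + β + 2) + 1 = 2 * n + (α + β + 3) by ring]
    field_simp
    ring
  rw [ratio]
  refine le_mul_of_one_le_right ?_ ?_
  · have := Real.Gamma_pos_of_pos p1
    have := Real.Gamma_pos_of_pos p2
    have := Real.Gamma_pos_of_pos p3
    have := Real.Gamma_pos_of_pos p4
    have := Real.Gamma_pos_of_pos p5
    have := Real.Gamma_pos_of_pos p6
    rw [jacobiNormSq]
    positivity
  · rw [le_div_iff₀ (by positivity), one_mul]
    have hm : 0 ≤ (2 * n + (α + β + 2)) ^ 2 * (1 - 2 * α ^ 2 - 2 * β ^ 2)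
        + (α + β) ^ 2 * (α - β) ^ 2 := by
      have : 0 ≤ 1 - 2 * α ^ 2 - 2 * β ^ 2 := by nlinarith
      positivity
    linarith

theorem four_pow_mul_jacobiNormSq_le (hα : α ∈ Set.Icc (-(1 : ℝ) / 2) (1 / 2))
    (hβ : β ∈ Set.Icc (-(1 : ℝ) / 2) (1 / 2)) {n : ℕ} (hn : 1 ≤ n) :
    4 ^ n * jacobiNormSq α β n ≤ Real.pi * 2 ^ (-(α + β)) := by
  have hmono : Monotone fun k : ℕ => 4 ^ (k + 1) * jacobiNormSq α β (k + 1) :=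
    monotone_nat_of_le_succ fun k => four_pow_mul_jacobiNormSq_le_succ hα hβ (by omega)
  have hlim := (tendsto_add_atTop_iff_nat 1).2 (tendsto_four_pow_mul_jacobiNormSq
    (α := α) (β := β) (by linarith [hα.1]) (by linarith [hβ.1]) (by linarith [hα.1, hβ.1]))
  have := hmono.ge_of_tendsto hlim (n - 1)
  simpa only [Nat.sub_add_cancel hn] using this

end JacobiNorm

section JacobiWave

open Polynomial Real Set Topology

/-- The weight `(1 - cos θ) ^ (α / 2 + 1 / 4) * (1 + cos θ) ^ (β / 2 + 1 / 4)`. -/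
noncomputable def waveWeight (α β θ : ℝ) : ℝ :=
  (1 - cos θ) ^ (α / 2 + 1 / 4) * (1 + cos θ) ^ (β / 2 + 1 / 4)

/-- The weighted polynomial `p (cos θ)`, which solves `u'' + (N ^ 2 + wavePotential) * u = 0` when
`p` is a solution of the Jacobi equation. -/
noncomputable def wave (α β : ℝ) (p : ℝ[X]) (θ : ℝ) : ℝ :=
  waveWeight α β θ * p.eval (cos θ)

/-- The derivative of `wave α β p` on `(0, π)`. -/
noncomputable def waveDeriv (α β : ℝ) (p : ℝ[X]) (θ : ℝ) : ℝ :=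
  waveWeight α β θ * (((α / 2 + 1 / 4) * (1 + cos θ) - (β / 2 + 1 / 4) * (1 - cos θ)) *
    p.eval (cos θ) - (1 - cos θ ^ 2) * (derivative p).eval (cos θ)) / sin θ

/-- The non-constant part of the potential in the equation satisfied by `wave`. -/
noncomputable def wavePotential (α β θ : ℝ) : ℝ :=
  (1 / 4 - α ^ 2) / (2 * (1 - cos θ)) + (1 / 4 - β ^ 2) / (2 * (1 + cos θ))

/-- An antiderivative of `wavePotential`. -/
noncomputable def wavePotentialPrimitive (α β θ : ℝ) : ℝ :=
  -((1 / 4 - α ^ 2) / 2 * (sin θ / (1 - cos θ))) + (1 / 4 - β ^ 2) / 2 * (sin θ / (1 + cos θ))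

/-- The derivative of `wavePotential`. -/
noncomputable def wavePotentialDeriv (α β θ : ℝ) : ℝ :=
  -((1 / 4 - α ^ 2) * sin θ / (2 * (1 - cos θ) ^ 2)) +
    (1 / 4 - β ^ 2) * sin θ / (2 * (1 + cos θ) ^ 2)

/-- The energy `u' ^ 2 + (N2 + wavePotential) * u ^ 2` of a wave. -/
noncomputable def waveEnergy (α β N2 : ℝ) (p : ℝ[X]) (θ : ℝ) : ℝ :=
  waveDeriv α β p θ ^ 2 + (N2 + wavePotential α β θ) * wave α β p θ ^ 2

variable {α β : ℝ} {p : ℝ[X]} {θ : ℝ}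

theorem one_sub_cos_pos (hθ : θ ∈ Ioo 0 π) : 0 < 1 - cos θ := by
  have := cos_lt_cos_of_nonneg_of_le_pi le_rfl hθ.2.le hθ.1
  rw [cos_zero] at this
  linarith

theorem one_add_cos_pos (hθ : θ ∈ Ioo 0 π) : 0 < 1 + cos θ := by
  have := cos_lt_cos_of_nonneg_of_le_pi hθ.1.le le_rfl hθ.2
  rw [cos_pi] at this
  linarith

theorem hasDerivAt_waveWeight (hθ : θ ∈ Ioo 0 π) :
    HasDerivAt (waveWeight α β) (waveWeight α β θ *
      ((α / 2 + 1 / 4) * (1 + cos θ) - (β / 2 + 1 / 4) * (1 - cos θ)) / sin θ) θ := by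
  have h1 := one_sub_cos_pos hθ
  have h2 := one_add_cos_pos hθ
  have hy := sin_pos_of_pos_of_lt_pi hθ.1 hθ.2
  have d1 := ((hasDerivAt_cos θ).const_sub 1).rpow_const (p := α / 2 + 1 / 4) (Or.inl h1.ne')
  have d2 := ((hasDerivAt_cos θ).const_add 1).rpow_const (p := β / 2 + 1 / 4) (Or.inl h2.ne')
  refine (d1.mul d2).congr_deriv ?_
  rw [rpow_sub_one h1.ne', rpow_sub_one h2.ne', waveWeight]
  have hs : sin θ ^ 2 = (1 - cos θ) * (1 + cos θ) := by rw [sin_sq]; ring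
  generalize (1 - cos θ) ^ (α / 2 + 1 / 4) = r1
  generalize (1 + cos θ) ^ (β / 2 + 1 / 4) = r2
  have h1' := h1.ne'
  have h2' := h2.ne'
  have hy' := hy.ne'
  field_simp
  rw [hs]
  ring

theorem hasDerivAt_wave (hθ : θ ∈ Ioo 0 π) :
    HasDerivAt (wave α β p) (waveDeriv α β p θ) θ := by
  have hy := (sin_pos_of_pos_of_lt_pi hθ.1 hθ.2).ne'
  have d := (hasDerivAt_waveWeight (α := α) (β := β) hθ).mul
    ((p.hasDerivAt (cos θ)).comp θ (hasDerivAt_cos θ))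
  refine d.congr_deriv ?_
  rw [waveDeriv, ← sin_sq]
  simp only [Function.comp_apply]
  field_simp
  ring

theorem hasDerivAt_waveDeriv {l : ℝ} (hp : IsJacobiSolution α β l p) (hθ : θ ∈ Ioo 0 π) :
    HasDerivAt (waveDeriv α β p)
      (-((l + ((α + β + 1) / 2) ^ 2 + wavePotential α β θ) * wave α β p θ)) θ := by
  have hy := (sin_pos_of_pos_of_lt_pi hθ.1 hθ.2).ne'
  have h1 := (one_sub_cos_pos hθ).ne'
  have h2 := (one_add_cos_pos hθ).ne'
  have hode := congrArg (eval (cos θ)) hp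
  simp only [eval_add, eval_mul, eval_sub, eval_one, eval_pow, eval_X, eval_C, eval_zero] at hode
  have dc := hasDerivAt_cos θ
  have dp := (p.hasDerivAt (cos θ)).comp θ dc
  have dp' := ((derivative p).hasDerivAt (cos θ)).comp θ dc
  have dk := ((dc.const_add 1).const_mul (α / 2 + 1 / 4)).sub
    ((dc.const_sub 1).const_mul (β / 2 + 1 / 4))
  have d := ((hasDerivAt_waveWeight (α := α) (β := β) hθ).mul
    ((dk.mul dp).sub (((dc.pow 2).const_sub 1).mul dp'))).div (hasDerivAt_sin θ) hy
  refine d.congr_deriv ?_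
  have hs : sin θ ^ 2 = (1 - cos θ) * (1 + cos θ) := by rw [sin_sq]; ring
  simp only [Pi.mul_apply, Pi.sub_apply, Pi.pow_apply, Function.comp_apply, wave, wavePotential]
  generalize waveWeight α β θ = r
  generalize eval (cos θ) p = P0 at *
  generalize eval (cos θ) (derivative p) = P1 at *
  generalize eval (cos θ) (derivative (derivative p)) = P2 at *
  generalize sin θ = y at *
  generalize cos θ = x at *
  have e1 : (1 / 4 - α ^ 2) / (2 * (1 - x)) + (1 / 4 - β ^ 2) / (2 * (1 + x)) =
      ((1 / 4 - α ^ 2) * (1 + x) + (1 / 4 - β ^ 2) * (1 - x)) / (2 * y ^ 2) := by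
    rw [hs]
    field_simp
  rw [e1]
  field_simp
  norm_num
  ring_nf
  rw [hs]
  linear_combination (64 * r * (1 - x) * (1 + x)) * hode

theorem hasDerivAt_wavePotential (hθ : θ ∈ Ioo 0 π) :
    HasDerivAt (wavePotential α β) (wavePotentialDeriv α β θ) θ := by
  have h1 := (one_sub_cos_pos hθ).ne'
  have h2 := (one_add_cos_pos hθ).ne'
  have dc := hasDerivAt_cos θ
  have d1 := (hasDerivAt_const θ (1 / 4 - α ^ 2)).div ((dc.const_sub 1).const_mul 2)
    (mul_ne_zero two_ne_zero h1)
  have d2 := (hasDerivAt_const θ (1 / 4 - β ^ 2)).div ((dc.const_add 1).const_mul 2)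
    (mul_ne_zero two_ne_zero h2)
  refine (d1.add d2).congr_deriv ?_
  rw [wavePotentialDeriv]
  field_simp
  ring

theorem hasDerivAt_wavePotentialPrimitive (hθ : θ ∈ Ioo 0 π) :
    HasDerivAt (wavePotentialPrimitive α β) (wavePotential α β θ) θ := by
  have h1 := (one_sub_cos_pos hθ).ne'
  have h2 := (one_add_cos_pos hθ).ne'
  have dc := hasDerivAt_cos θ
  have ds := hasDerivAt_sin θ
  have d1 := ((ds.div (dc.const_sub 1) h1).const_mul ((1 / 4 - α ^ 2) / 2)).neg
  have d2 := (ds.div (dc.const_add 1) h2).const_mul ((1 / 4 - β ^ 2) / 2)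
  refine (d1.add d2).congr_deriv ?_
  rw [wavePotential]
  have hs : sin θ ^ 2 = (1 - cos θ) * (1 + cos θ) := by rw [sin_sq]; ring
  have e1 : (cos θ * (1 - cos θ) - sin θ * - -sin θ) / (1 - cos θ) ^ 2 = -1 / (1 - cos θ) := by
    field_simp
    linear_combination -hs
  have e2 : (cos θ * (1 + cos θ) - sin θ * -sin θ) / (1 + cos θ) ^ 2 = 1 / (1 + cos θ) := by
    field_simp
    linear_combination hs
  rw [e1, e2]
  field_simp

theorem mul_sin_le_two_mul_one_sub_cos (hθ : θ ∈ Ioo 0 π) : θ * sin θ ≤ 2 * (1 - cos θ) := by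
  obtain ⟨h0, hπ⟩ := hθ
  have hc : 0 < cos (θ / 2) := cos_pos_of_mem_Ioo ⟨by linarith, by linarith⟩
  have hs : 0 < sin (θ / 2) := sin_pos_of_pos_of_lt_pi (by linarith) (by linarith)
  have ht := lt_tan (x := θ / 2) (by linarith) (by linarith)
  rw [tan_eq_sin_div_cos, lt_div_iff₀ hc] at ht
  have e1 : sin θ = 2 * sin (θ / 2) * cos (θ / 2) := by rw [← sin_two_mul]; ring_nf
  have e2 : cos θ = 1 - 2 * sin (θ / 2) ^ 2 := by
    have := cos_two_mul (θ / 2)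
    rw [cos_sq', mul_div_cancel₀ θ two_ne_zero] at this
    linarith
  rw [e1, e2]
  nlinarith

theorem two_mul_wavePotential_add_nonneg (hα : α ^ 2 ≤ 1 / 4) (hβ : β ^ 2 ≤ 1 / 4)
    (hθ : θ ∈ Ioo 0 π) : 0 ≤ 2 * wavePotential α β θ + θ * wavePotentialDeriv α β θ := by
  have h1 := one_sub_cos_pos hθ
  have h2 := one_add_cos_pos hθ
  have hy := sin_pos_of_pos_of_lt_pi hθ.1 hθ.2
  have h3 := mul_sin_le_two_mul_one_sub_cos hθ
  have e : 2 * wavePotential α β θ + θ * wavePotentialDeriv α β θ =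
      (1 / 4 - α ^ 2) * (2 * (1 - cos θ) - θ * sin θ) / (2 * (1 - cos θ) ^ 2) +
      (1 / 4 - β ^ 2) * (2 * (1 + cos θ) + θ * sin θ) / (2 * (1 + cos θ) ^ 2) := by
    rw [wavePotential, wavePotentialDeriv]
    field_simp
    ring
  rw [e]
  have := hθ.1
  have i1 : 0 ≤ 1 / 4 - α ^ 2 := by linarith
  have i2 : 0 ≤ 1 / 4 - β ^ 2 := by linarith
  have i3 : 0 ≤ 2 * (1 - cos θ) - θ * sin θ := by linarith
  positivity

theorem tendsto_sub_sin_div_sin_sq :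
    Tendsto (fun θ : ℝ => (θ - sin θ) / sin θ ^ 2) (𝓝[>] 0) (𝓝 0) := by
  have hid : Tendsto (fun θ : ℝ => θ) (𝓝[>] 0) (𝓝 0) := tendsto_nhdsWithin_of_tendsto_nhds
    tendsto_id
  have hmem : Ioo (0 : ℝ) 1 ∈ 𝓝[>] (0 : ℝ) := Ioo_mem_nhdsGT one_pos
  refine tendsto_of_tendsto_of_tendsto_of_le_of_le' tendsto_const_nhds hid ?_ ?_
  · filter_upwards [hmem] with θ hθ
    exact div_nonneg (sub_nonneg.2 (sin_le hθ.1.le)) (sq_nonneg _)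
  · filter_upwards [hmem] with θ ⟨h0, h1⟩
    have h2 := sin_gt_sub_cube h0
    have h3 : θ / 2 ≤ sin θ := by nlinarith [mul_pos h0 h0]
    rw [div_le_iff₀ (pow_pos (by linarith) 2)]
    have h4 : (θ / 2) ^ 2 ≤ sin θ ^ 2 := by gcongr
    nlinarith [mul_le_mul_of_nonneg_left h4 h0.le, pow_pos h0 3]

theorem continuous_waveWeight (hα : -1 / 2 ≤ α) (hβ : -1 / 2 ≤ β) :
    Continuous (waveWeight α β) := by
  unfold waveWeight
  exact ((continuous_const.sub continuous_cos).rpow_const fun _ => Or.inr (by linarith)).mul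
    ((continuous_const.add continuous_cos).rpow_const fun _ => Or.inr (by linarith))

theorem continuous_wave (hα : -1 / 2 ≤ α) (hβ : -1 / 2 ≤ β) : Continuous (wave α β p) :=
  (continuous_waveWeight hα hβ).mul (p.continuous.comp continuous_cos)

theorem tendsto_mul_wavePotential_add_primitive :
    Tendsto (fun θ => θ * wavePotential α β θ + wavePotentialPrimitive α β θ) (𝓝[>] 0) (𝓝 0) := by
  have hc : Tendsto (fun θ => (1 / 4 - β ^ 2) * (θ + sin θ) / (2 * (1 + cos θ))) (𝓝[>] 0)
      (𝓝 0) := by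
    have : ContinuousAt (fun θ => (1 / 4 - β ^ 2) * (θ + sin θ) / (2 * (1 + cos θ))) 0 := by
      refine ContinuousAt.div (by fun_prop) (by fun_prop) ?_
      norm_num
    simpa [ContinuousAt] using tendsto_nhdsWithin_of_tendsto_nhds (s := Ioi 0) this
  have hd : Tendsto (fun θ => (1 / 4 - α ^ 2) * (1 + cos θ) / 2) (𝓝[>] 0)
      (𝓝 ((1 / 4 - α ^ 2) * (1 + cos 0) / 2)) :=
    tendsto_nhdsWithin_of_tendsto_nhds (Continuous.tendsto (by fun_prop) 0)
  have h := (hd.mul tendsto_sub_sin_div_sin_sq).add hc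
  rw [mul_zero, add_zero] at h
  refine h.congr' ?_
  filter_upwards [Ioo_mem_nhdsGT pi_pos] with θ hθ
  have h1 := (one_sub_cos_pos hθ).ne'
  have h2 := (one_add_cos_pos hθ).ne'
  have hs : sin θ ^ 2 = (1 - cos θ) * (1 + cos θ) := by rw [sin_sq]; ring
  rw [wavePotential, wavePotentialPrimitive, hs]
  field_simp
  ring

theorem tendsto_mul_waveEnergy_sub {N2 : ℝ} (hα : -1 / 2 ≤ α) (hβ : -1 / 2 ≤ β) :
    Tendsto (fun θ => θ * waveEnergy α β N2 p θ - wave α β p θ * waveDeriv α β p θ)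
      (𝓝[>] 0) (𝓝 0) := by
  have hw := continuous_waveWeight hα hβ
  have hp : Continuous fun θ => p.eval (cos θ) := p.continuous.comp continuous_cos
  have hp' : Continuous fun θ => (derivative p).eval (cos θ) :=
    (derivative p).continuous.comp continuous_cos
  have hd : Tendsto (fun θ => (α + 1 / 2) * (waveWeight α β θ * p.eval (cos θ)) ^ 2) (𝓝[>] 0)
      (𝓝 ((α + 1 / 2) * (waveWeight α β 0 * p.eval (cos 0)) ^ 2)) :=
    tendsto_nhdsWithin_of_tendsto_nhds (Continuous.tendsto (by fun_prop) 0)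
  set f : ℝ → ℝ := fun θ => (waveWeight α β θ * p.eval (cos θ)) ^ 2 * (θ * N2 +
    (θ * ((1 / 4 - β ^ 2) / 2 + (-2 * (α + 1 / 2) * ((α + β + 1) / 2) +
      ((α + β + 1) / 2) ^ 2 * (1 - cos θ)) - (1 / 4 - α ^ 2) / 2) + (α + β + 1) / 2 * sin θ)
      / (1 + cos θ)) + waveWeight α β θ ^ 2 *
    (-2 * θ * ((α + 1 / 2) - (α + β + 1) / 2 * (1 - cos θ)) * p.eval (cos θ) *
      (derivative p).eval (cos θ) + θ * sin θ ^ 2 * (derivative p).eval (cos θ) ^ 2 +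
      sin θ * p.eval (cos θ) * (derivative p).eval (cos θ)) with hf
  have hc : Tendsto f (𝓝[>] 0) (𝓝 0) := by
    have hdiv : ContinuousAt (fun θ => (θ * ((1 / 4 - β ^ 2) / 2 + (-2 * (α + 1 / 2) *
        ((α + β + 1) / 2) + ((α + β + 1) / 2) ^ 2 * (1 - cos θ)) - (1 / 4 - α ^ 2) / 2) +
        (α + β + 1) / 2 * sin θ) / (1 + cos θ)) 0 := by
      refine ContinuousAt.div (by fun_prop) (by fun_prop) ?_
      norm_num
    have : ContinuousAt f 0 := by
      refine ContinuousAt.add (ContinuousAt.mul ?_ (ContinuousAt.add ?_ hdiv)) ?_ <;> fun_prop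
    simpa [ContinuousAt, hf] using tendsto_nhdsWithin_of_tendsto_nhds (s := Ioi 0) this
  have h := (hd.mul tendsto_sub_sin_div_sin_sq).add hc
  rw [mul_zero, add_zero] at h
  refine h.congr' ?_
  filter_upwards [Ioo_mem_nhdsGT pi_pos] with θ hθ
  have h1 := (one_sub_cos_pos hθ).ne'
  have h2 := (one_add_cos_pos hθ).ne'
  have hy := (sin_pos_of_pos_of_lt_pi hθ.1 hθ.2).ne'
  have hs : sin θ ^ 2 = (1 - cos θ) * (1 + cos θ) := by rw [sin_sq]; ring
  simp only [hf, waveEnergy, wavePotential, wave, waveDeriv]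
  generalize waveWeight α β θ = r
  generalize eval (cos θ) p = P0 at *
  generalize eval (cos θ) (derivative p) = P1 at *
  generalize sin θ = y at *
  generalize cos θ = x at *
  have e1 : ∀ c, c / (2 * (1 - x)) = c * (1 + x) / (2 * y ^ 2) := fun c => by rw [hs]; field_simp
  have e2 : ∀ c, c / (2 * (1 + x)) = c * (1 - x) / (2 * y ^ 2) := fun c => by rw [hs]; field_simp
  have e3 : ∀ c, c / (1 + x) = c * (1 - x) / y ^ 2 := fun c => by rw [hs]; field_simp
  rw [e1, e2, e3]
  field_simp
  have hs2 : y ^ 2 = 1 - x ^ 2 := by rw [hs]; ring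
  have hs3 : y ^ 3 = y * (1 - x ^ 2) := by rw [← hs2]; ring
  have hs4 : y ^ 4 = (1 - x ^ 2) ^ 2 := by rw [← hs2]; ring
  ring_nf
  simp only [hs2, hs3, hs4]
  ring

theorem nonneg_of_hasDerivAt_of_tendsto {F F' : ℝ → ℝ} {b : ℝ}
    (hF : ∀ t ∈ Ioo 0 b, HasDerivAt F (F' t) t) (hF' : ∀ t ∈ Ioo 0 b, 0 ≤ F' t)
    (h0 : Tendsto F (𝓝[>] 0) (𝓝 0)) {t : ℝ} (ht : t ∈ Ioo 0 b) : 0 ≤ F t := by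
  have hmono : MonotoneOn F (Ioo 0 b) := by
    refine monotoneOn_of_deriv_nonneg (convex_Ioo 0 b)
      (fun s hs => (hF s hs).continuousAt.continuousWithinAt) ?_ ?_ <;> rw [interior_Ioo]
    · exact fun s hs => (hF s hs).differentiableAt.differentiableWithinAt
    · exact fun s hs => by rw [(hF s hs).deriv]; exact hF' s hs
  refine le_of_tendsto h0 ?_
  filter_upwards [Ioo_mem_nhdsGT ht.1] with s hs
  exact hmono ⟨hs.1, hs.2.trans ht.2⟩ ht hs.2.le

theorem hasDerivAt_mul_waveEnergy_sub {l N2 : ℝ} (hp : IsJacobiSolution α β l p)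
    (hN : N2 = l + ((α + β + 1) / 2) ^ 2) (hθ : θ ∈ Ioo 0 π) :
    HasDerivAt (fun t => t * waveEnergy α β N2 p t - wave α β p t * waveDeriv α β p t)
      (2 * N2 * wave α β p θ ^ 2 +
        (2 * wavePotential α β θ + θ * wavePotentialDeriv α β θ) * wave α β p θ ^ 2) θ := by
  have du := hasDerivAt_wave (α := α) (β := β) (p := p) hθ
  have dv := hasDerivAt_waveDeriv hp hθ
  have dg := hasDerivAt_wavePotential (α := α) (β := β) hθ
  rw [← hN] at dv
  refine (((hasDerivAt_id θ).mul ((dv.pow 2).add ((dg.const_add N2).mul (du.pow 2)))).sub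
    (du.mul dv)).congr_deriv ?_
  simp only [Pi.add_apply, Pi.mul_apply, Pi.pow_apply, id]
  norm_num
  ring

theorem tendsto_integral_wave_sq (hα : -1 / 2 ≤ α) (hβ : -1 / 2 ≤ β) (c : ℝ) :
    Tendsto (fun θ => c * ∫ t in 0..θ, wave α β p t ^ 2) (𝓝[>] 0) (𝓝 0) := by
  have hc : Continuous fun t => wave α β p t ^ 2 := (continuous_wave hα hβ).pow 2
  have := ((hc.integral_hasStrictDerivAt 0 0).hasDerivAt.continuousAt.const_mul c)
  simpa [ContinuousAt] using tendsto_nhdsWithin_of_tendsto_nhds (s := Ioi 0) this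

theorem hasDerivAt_integral_wave_sq (hα : -1 / 2 ≤ α) (hβ : -1 / 2 ≤ β) (c : ℝ) :
    HasDerivAt (fun θ => c * ∫ t in 0..θ, wave α β p t ^ 2) (c * wave α β p θ ^ 2) θ :=
  ((((continuous_wave hα hβ).pow 2).integral_hasStrictDerivAt 0 θ).hasDerivAt).const_mul c

theorem sq_le_quarter (hα : α ∈ Icc (-(1 : ℝ) / 2) (1 / 2)) : α ^ 2 ≤ 1 / 4 := by
  nlinarith [hα.1, hα.2]

theorem integral_wave_sq_le {l N2 : ℝ} (hα : α ∈ Icc (-(1 : ℝ) / 2) (1 / 2))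
    (hβ : β ∈ Icc (-(1 : ℝ) / 2) (1 / 2)) (hp : IsJacobiSolution α β l p)
    (hN : N2 = l + ((α + β + 1) / 2) ^ 2) (hθ : θ ∈ Ioo 0 π) :
    2 * N2 * ∫ t in 0..θ, wave α β p t ^ 2 ≤
      θ * waveEnergy α β N2 p θ - wave α β p θ * waveDeriv α β p θ := by
  rw [← sub_nonneg]
  have h0 := (tendsto_mul_waveEnergy_sub (p := p) (N2 := N2) hα.1 hβ.1).sub
    (tendsto_integral_wave_sq (p := p) hα.1 hβ.1 (2 * N2))
  rw [sub_zero] at h0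
  refine nonneg_of_hasDerivAt_of_tendsto (fun t ht => (hasDerivAt_mul_waveEnergy_sub hp hN ht).sub
    (hasDerivAt_integral_wave_sq hα.1 hβ.1 (2 * N2))) (fun t ht => ?_) h0 hθ
  have := two_mul_wavePotential_add_nonneg (sq_le_quarter hα) (sq_le_quarter hβ) ht
  rw [add_sub_cancel_left]
  positivity

theorem le_integral_wave_sq {l N2 m : ℝ} (hα : α ∈ Icc (-(1 : ℝ) / 2) (1 / 2))
    (hβ : β ∈ Icc (-(1 : ℝ) / 2) (1 / 2)) (hp : IsJacobiSolution α β l p)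
    (hN : N2 = l + ((α + β + 1) / 2) ^ 2) (hm : ∀ t ∈ Ioo 0 π, wave α β p t ^ 2 ≤ m)
    (hθ : θ ∈ Ioo 0 π) :
    θ * waveEnergy α β N2 p θ - wave α β p θ * waveDeriv α β p θ ≤
      2 * N2 * (∫ t in 0..θ, wave α β p t ^ 2) +
        m * (θ * wavePotential α β θ + wavePotentialPrimitive α β θ) := by
  rw [← sub_nonneg]
  have h0 := ((tendsto_integral_wave_sq (p := p) hα.1 hβ.1 (2 * N2)).add
    ((tendsto_mul_wavePotential_add_primitive (α := α) (β := β)).const_mul m)).sub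
    (tendsto_mul_waveEnergy_sub (p := p) (N2 := N2) hα.1 hβ.1)
  rw [mul_zero, add_zero, sub_zero] at h0
  refine nonneg_of_hasDerivAt_of_tendsto (fun t ht =>
    ((hasDerivAt_integral_wave_sq hα.1 hβ.1 (2 * N2)).add ((((hasDerivAt_id t).mul
      (hasDerivAt_wavePotential ht)).add (hasDerivAt_wavePotentialPrimitive ht)).const_mul m)).sub
    (hasDerivAt_mul_waveEnergy_sub hp hN ht)) (fun t ht => ?_) h0 hθ
  have h1 := two_mul_wavePotential_add_nonneg (sq_le_quarter hα) (sq_le_quarter hβ) ht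
  have h2 := mul_nonneg h1 (sub_nonneg.2 (hm t ht))
  simp only [id]
  linarith

theorem IsJacobiSolution.comp_neg_X {l : ℝ} (hp : IsJacobiSolution α β l p) :
    IsJacobiSolution β α l (p.comp (-X)) := by
  have h := congrArg (fun q => q.comp (-X)) hp
  simp only [add_comp, sub_comp, mul_comp, one_comp, pow_comp, X_comp, C_comp, zero_comp] at h
  unfold IsJacobiSolution
  have d1 : derivative (p.comp (-X)) = -(derivative p).comp (-X) := by
    rw [derivative_comp]
    simp
  have d2 : derivative (derivative (p.comp (-X))) = (derivative (derivative p)).comp (-X) := by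
    rw [d1, derivative_neg, derivative_comp]
    simp
  rw [d2, d1, add_comm β α, ← h]
  simp only [C_sub]
  ring

theorem wave_comp_neg_X : wave β α (p.comp (-X)) θ = wave α β p (π - θ) := by
  simp only [wave, waveWeight, cos_pi_sub, eval_comp, eval_neg, eval_X, sub_neg_eq_add,
    ← sub_eq_add_neg]
  ring

theorem waveDeriv_comp_neg_X : waveDeriv β α (p.comp (-X)) θ = -waveDeriv α β p (π - θ) := by
  simp only [waveDeriv, waveWeight, cos_pi_sub, sin_pi_sub, eval_comp, eval_neg, eval_X,
    sub_neg_eq_add, ← sub_eq_add_neg, derivative_comp, derivative_neg, derivative_X, eval_mul,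
    eval_one]
  ring

theorem wavePotential_swap : wavePotential β α θ = wavePotential α β (π - θ) := by
  simp only [wavePotential, cos_pi_sub, sub_neg_eq_add, ← sub_eq_add_neg]
  ring

theorem wavePotentialPrimitive_swap :
    wavePotentialPrimitive β α θ = -wavePotentialPrimitive α β (π - θ) := by
  simp only [wavePotentialPrimitive, cos_pi_sub, sin_pi_sub, sub_neg_eq_add, ← sub_eq_add_neg]
  ring

theorem waveEnergy_comp_neg_X (N2 : ℝ) :
    waveEnergy β α N2 (p.comp (-X)) θ = waveEnergy α β N2 p (π - θ) := by
  rw [waveEnergy, waveEnergy, waveDeriv_comp_neg_X, wavePotential_swap, wave_comp_neg_X, neg_sq]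

theorem integral_wave_comp_neg_X_sq :
    ∫ t in 0..θ, wave β α (p.comp (-X)) t ^ 2 = ∫ t in (π - θ)..π, wave α β p t ^ 2 := by
  simp only [wave_comp_neg_X]
  rw [intervalIntegral.integral_comp_sub_left (fun t => wave α β p t ^ 2) π, sub_zero]

theorem integral_wave_sq_add (hα : -1 / 2 ≤ α) (hβ : -1 / 2 ≤ β) :
    (∫ t in 0..θ, wave α β p t ^ 2) + ∫ t in θ..π, wave α β p t ^ 2 =
      ∫ t in 0..π, wave α β p t ^ 2 := by
  have hc : Continuous fun t => wave α β p t ^ 2 := (continuous_wave hα hβ).pow 2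
  exact intervalIntegral.integral_add_adjacent_intervals (hc.intervalIntegrable _ _)
    (hc.intervalIntegrable _ _)

theorem integral_wave_sq_le_pi_mul_waveEnergy {l N2 : ℝ} (hα : α ∈ Icc (-(1 : ℝ) / 2) (1 / 2))
    (hβ : β ∈ Icc (-(1 : ℝ) / 2) (1 / 2)) (hp : IsJacobiSolution α β l p)
    (hN : N2 = l + ((α + β + 1) / 2) ^ 2) (hθ : θ ∈ Ioo 0 π) :
    2 * N2 * ∫ t in 0..π, wave α β p t ^ 2 ≤ π * waveEnergy α β N2 p θ := by
  have h1 := integral_wave_sq_le hα hβ hp hN hθ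
  have h2 := integral_wave_sq_le (N2 := N2) hβ hα hp.comp_neg_X (by rw [hN, add_comm β α])
    (θ := π - θ) ⟨sub_pos.2 hθ.2, sub_lt_self _ hθ.1⟩
  rw [waveEnergy_comp_neg_X, wave_comp_neg_X, waveDeriv_comp_neg_X, integral_wave_comp_neg_X_sq,
    sub_sub_cancel] at h2
  rw [← integral_wave_sq_add (θ := θ) hα.1 hβ.1]
  linarith

theorem pi_mul_waveEnergy_le {l N2 m : ℝ} (hα : α ∈ Icc (-(1 : ℝ) / 2) (1 / 2))
    (hβ : β ∈ Icc (-(1 : ℝ) / 2) (1 / 2)) (hp : IsJacobiSolution α β l p)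
    (hN : N2 = l + ((α + β + 1) / 2) ^ 2) (hm : ∀ t ∈ Ioo 0 π, wave α β p t ^ 2 ≤ m)
    (hθ : θ ∈ Ioo 0 π) :
    π * waveEnergy α β N2 p θ ≤
      2 * N2 * (∫ t in 0..π, wave α β p t ^ 2) + m * (π * wavePotential α β θ) := by
  have hsub : ∀ t ∈ Ioo 0 π, π - t ∈ Ioo 0 π := fun t ht => ⟨sub_pos.2 ht.2, sub_lt_self _ ht.1⟩
  have h1 := le_integral_wave_sq hα hβ hp hN hm hθ
  have h2 := le_integral_wave_sq (N2 := N2) hβ hα hp.comp_neg_X (by rw [hN, add_comm β α])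
    (fun t ht => by rw [wave_comp_neg_X]; exact hm _ (hsub t ht)) (hsub θ hθ)
  rw [waveEnergy_comp_neg_X, wave_comp_neg_X, waveDeriv_comp_neg_X, integral_wave_comp_neg_X_sq,
    wavePotential_swap, wavePotentialPrimitive_swap, sub_sub_cancel] at h2
  rw [← integral_wave_sq_add (θ := θ) hα.1 hβ.1]
  linarith

theorem pi_mul_wave_zero_sq_le {l N2 : ℝ} (hα : α ∈ Icc (-(1 : ℝ) / 2) (1 / 2))
    (hβ : β ∈ Icc (-(1 : ℝ) / 2) (1 / 2)) (hp : IsJacobiSolution α β l p)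
    (hN : N2 = l + ((α + β + 1) / 2) ^ 2) (hN0 : 0 < N2)
    (hm : ∀ t ∈ Ioo 0 π, wave α β p t ^ 2 ≤ wave α β p 0 ^ 2) :
    π * wave α β p 0 ^ 2 ≤ 2 * ∫ t in 0..π, wave α β p t ^ 2 := by
  rcases hα.1.lt_or_eq with h | h
  · have : wave α β p 0 = 0 := by
      rw [wave, waveWeight, cos_zero, sub_self, zero_rpow (by linarith)]
      ring
    rw [this]
    have : 0 ≤ ∫ t in 0..π, wave α β p t ^ 2 :=
      intervalIntegral.integral_nonneg pi_pos.le fun t _ => sq_nonneg _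
    linarith
  · have ha : 1 / 4 - α ^ 2 = 0 := by rw [← h]; norm_num
    have hw := continuous_wave (p := p) hα.1 hβ.1
    have hc : ContinuousAt (fun t => π * N2 * wave α β p t ^ 2 +
        π * (wave α β p t ^ 2 - wave α β p 0 ^ 2) * wavePotential α β t) 0 := by
      have : ContinuousAt (wavePotential α β) 0 := by
        unfold wavePotential
        simp only [ha, zero_div, zero_add]
        refine ContinuousAt.div (by fun_prop) (by fun_prop) ?_
        norm_num
      fun_prop
    have hl := tendsto_nhdsWithin_of_tendsto_nhds (s := Ioi 0) hc.tendsto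
    have hle := le_of_tendsto hl (b := 2 * N2 * ∫ t in 0..π, wave α β p t ^ 2) (by
      filter_upwards [Ioo_mem_nhdsGT pi_pos] with t ht
      have h1 := pi_mul_waveEnergy_le hα hβ hp hN hm ht
      rw [waveEnergy] at h1
      nlinarith [mul_nonneg pi_pos.le (sq_nonneg (waveDeriv α β p t))])
    rw [sub_self, mul_zero, zero_mul, add_zero] at hle
    exact le_of_mul_le_mul_left (by linarith) hN0

theorem pi_mul_wave_sq_le {l N2 : ℝ} (hα : α ∈ Icc (-(1 : ℝ) / 2) (1 / 2))
    (hβ : β ∈ Icc (-(1 : ℝ) / 2) (1 / 2)) (hp : IsJacobiSolution α β l p)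
    (hN : N2 = l + ((α + β + 1) / 2) ^ 2) (hN0 : 0 < N2) (hθ : θ ∈ Icc 0 π) :
    π * wave α β p θ ^ 2 ≤ 2 * ∫ t in 0..π, wave α β p t ^ 2 := by
  obtain ⟨s, hs, hmax⟩ := isCompact_Icc.exists_isMaxOn (nonempty_Icc.2 pi_pos.le)
    ((continuous_wave (p := p) hα.1 hβ.1).pow 2).continuousOn
  have hm : ∀ t ∈ Ioo 0 π, wave α β p t ^ 2 ≤ wave α β p s ^ 2 := fun t ht =>
    hmax (Ioo_subset_Icc_self ht)
  refine (mul_le_mul_of_nonneg_left (hmax hθ) pi_pos.le).trans ?_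
  rcases hs.1.eq_or_lt with h0 | h0
  · subst h0
    exact pi_mul_wave_zero_sq_le hα hβ hp hN hN0 hm
  rcases hs.2.eq_or_lt with hπ | hπ
  · subst hπ
    have h := pi_mul_wave_zero_sq_le hβ hα hp.comp_neg_X (by rw [hN, add_comm β α]) hN0
      fun t ht => by
        rw [wave_comp_neg_X, wave_comp_neg_X, sub_zero]
        exact hm _ ⟨sub_pos.2 ht.2, sub_lt_self _ ht.1⟩
    rwa [wave_comp_neg_X, integral_wave_comp_neg_X_sq, sub_zero, sub_self] at h
  · have h1 := pi_mul_waveEnergy_le hα hβ hp hN hm ⟨h0, hπ⟩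
    rw [waveEnergy] at h1
    refine le_of_mul_le_mul_left ?_ hN0
    rw [Pi.pow_apply]
    nlinarith [mul_nonneg pi_pos.le (sq_nonneg (waveDeriv α β p s))]

theorem integral_wave_sq_le_of_abs_wave_le {l N2 M : ℝ} (hα : α ∈ Icc (-(1 : ℝ) / 2) (1 / 2))
    (hβ : β ∈ Icc (-(1 : ℝ) / 2) (1 / 2)) (hp : IsJacobiSolution α β l p)
    (hN : N2 = l + ((α + β + 1) / 2) ^ 2) (hN0 : 0 < N2) (hM : ∀ t, |wave α β p t| ≤ M) :
    2 * N2 * (∫ t in 0..π, wave α β p t ^ 2) ≤ π * (N2 + 9 / 2) * M ^ 2 := by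
  have hπ := pi_gt_three
  obtain ⟨ξ, hξ, hv⟩ := exists_hasDerivAt_eq_slope (wave α β p) (waveDeriv α β p)
    (a := π / 3) (b := 2 * π / 3) (by linarith) (continuous_wave hα.1 hβ.1).continuousOn
    (fun t ht => hasDerivAt_wave ⟨by linarith [ht.1], by linarith [ht.2]⟩)
  have hξ' : ξ ∈ Ioo 0 π := ⟨by linarith [hξ.1], by linarith [hξ.2]⟩
  have hM0 : 0 ≤ M := (abs_nonneg _).trans (hM 0)
  have hvM : |waveDeriv α β p ξ| ≤ 2 * M := by
    have hpos : 0 < 2 * π / 3 - π / 3 := by linarith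
    rw [hv, abs_div, abs_of_pos hpos, div_le_iff₀ hpos]
    have := (abs_sub (wave α β p (2 * π / 3)) (wave α β p (π / 3))).trans
      (add_le_add (hM _) (hM _))
    nlinarith
  have hg : wavePotential α β ξ ≤ 1 / 2 := by
    have c1 : cos ξ ≤ 1 / 2 := by
      rw [← cos_pi_div_three]
      exact cos_le_cos_of_nonneg_of_le_pi (by linarith) hξ'.2.le hξ.1.le
    have c2 : -(1 / 2) ≤ cos ξ := by
      rw [← cos_pi_div_three, ← cos_pi_sub]
      exact cos_le_cos_of_nonneg_of_le_pi hξ'.1.le (by linarith) (by linarith [hξ.2])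
    have g1 : (1 / 4 - α ^ 2) / (2 * (1 - cos ξ)) ≤ 1 / 4 := by
      rw [div_le_iff₀ (by linarith)]
      nlinarith [sq_nonneg α]
    have g2 : (1 / 4 - β ^ 2) / (2 * (1 + cos ξ)) ≤ 1 / 4 := by
      rw [div_le_iff₀ (by linarith)]
      nlinarith [sq_nonneg β]
    rw [wavePotential]
    linarith
  have hE : waveEnergy α β N2 p ξ ≤ (N2 + 9 / 2) * M ^ 2 := by
    have e1 : waveDeriv α β p ξ ^ 2 ≤ (2 * M) ^ 2 := sq_le_sq' (abs_le.1 hvM).1 (abs_le.1 hvM).2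
    have e2 : wave α β p ξ ^ 2 ≤ M ^ 2 := sq_le_sq' (abs_le.1 (hM ξ)).1 (abs_le.1 (hM ξ)).2
    have e3 : (N2 + wavePotential α β ξ) * wave α β p ξ ^ 2 ≤ (N2 + 1 / 2) * M ^ 2 := by gcongr
    rw [waveEnergy]
    linarith
  refine (integral_wave_sq_le_pi_mul_waveEnergy hα hβ hp hN hξ').trans ?_
  rw [mul_assoc]
  gcongr

theorem integral_wave_sq_eq_jacobiInt (hα : α ∈ Icc (-(1 : ℝ) / 2) (1 / 2))
    (hβ : β ∈ Icc (-(1 : ℝ) / 2) (1 / 2)) :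
    ∫ t in 0..π, wave α β p t ^ 2 = jacobiInt α β (p * p) := by
  have hα1 : -1 < α := by linarith [hα.1]
  have hβ1 : -1 < β := by linarith [hβ.1]
  set g : ℝ → ℝ := fun x => (1 - x) ^ α * (1 + x) ^ β * (p * p).eval x with hg
  have heq : ∀ t ∈ Ioo 0 π, wave α β p t ^ 2 = -((g ∘ cos) t * -sin t) := by
    intro t ht
    have h1 := one_sub_cos_pos ht
    have h2 := one_add_cos_pos ht
    have hy := sin_pos_of_pos_of_lt_pi ht.1 ht.2
    have hs : sin t = (1 - cos t) ^ (1 / 2 : ℝ) * (1 + cos t) ^ (1 / 2 : ℝ) := by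
      rw [← mul_rpow h1.le h2.le, ← sqrt_eq_rpow, ← sqrt_sq hy.le, sin_sq]
      ring_nf
    have e1 : ((1 - cos t) ^ (α / 2 + 1 / 4)) ^ 2 = (1 - cos t) ^ α * (1 - cos t) ^ (1 / 2 : ℝ) := by
      rw [← rpow_natCast, ← rpow_mul h1.le, ← rpow_add h1]
      norm_num
      ring_nf
    have e2 : ((1 + cos t) ^ (β / 2 + 1 / 4)) ^ 2 = (1 + cos t) ^ β * (1 + cos t) ^ (1 / 2 : ℝ) := by
      rw [← rpow_natCast, ← rpow_mul h2.le, ← rpow_add h2]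
      norm_num
      ring_nf
    simp only [hg, Function.comp_apply, wave, waveWeight, mul_pow, eval_mul]
    rw [e1, e2, hs]
    ring
  have hgc : ContinuousOn g (Ioo (-1) 1) := by
    have c1 : ContinuousOn (fun x : ℝ => (1 - x) ^ α) (Ioo (-1) 1) :=
      ContinuousOn.rpow_const (by fun_prop) fun x hx => Or.inl (by linarith [hx.2])
    have c2 : ContinuousOn (fun x : ℝ => (1 + x) ^ β) (Ioo (-1) 1) :=
      ContinuousOn.rpow_const (by fun_prop) fun x hx => Or.inl (by linarith [hx.1])
    exact (c1.mul c2).mul (p * p).continuous.continuousOn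
  have hint : IntegrableOn g (Icc (-1) 1) := by
    have := intervalIntegrable_jacobiWeight_mul hα1 hβ1 (p * p)
    rwa [intervalIntegrable_iff_integrableOn_Icc_of_le (by norm_num)] at this
  have hwint : IntegrableOn (fun t => (g ∘ cos) t * -sin t) (Icc 0 π) := by
    have hc : Continuous fun t => wave α β p t ^ 2 := (continuous_wave hα.1 hβ.1).pow 2
    rw [integrableOn_Icc_iff_integrableOn_Ioo]
    refine (((hc.integrableOn_Icc (a := 0) (b := π)).mono_set Ioo_subset_Icc_self).neg).congr_fun
      (fun t ht => ?_) measurableSet_Ioo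
    rw [Pi.neg_apply, heq t ht, neg_neg]
  have hsub := intervalIntegral.integral_comp_mul_deriv''' (a := 0) (b := π) (f := cos)
    (f' := fun t => -sin t) (g := g) continuous_cos.continuousOn
    (fun t _ => (hasDerivAt_cos t).hasDerivWithinAt) (hgc.mono ?_) (hint.mono_set ?_)
    (by rwa [uIcc_of_le pi_pos.le])
  · rw [cos_zero, cos_pi, intervalIntegral.integral_symm (-1)] at hsub
    rw [jacobiInt, ← neg_neg (∫ x in (-1 : ℝ)..1, _), ← hsub, ← intervalIntegral.integral_neg,
      intervalIntegral.integral_of_le pi_pos.le, intervalIntegral.integral_of_le pi_pos.le,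
      integral_Ioc_eq_integral_Ioo, integral_Ioc_eq_integral_Ioo]
    exact setIntegral_congr_fun measurableSet_Ioo heq
  · rintro _ ⟨t, ht, rfl⟩
    rw [min_eq_left pi_pos.le, max_eq_right pi_pos.le] at ht
    exact ⟨by linarith [one_add_cos_pos ht], by linarith [one_sub_cos_pos ht]⟩
  · rintro _ ⟨t, ht, rfl⟩
    exact ⟨neg_one_le_cos t, cos_le_one t⟩

theorem abs_wave_le_jacobiSup (hα : -1 / 2 ≤ α) (hβ : -1 / 2 ≤ β) :
    |wave α β p θ| ≤ jacobiSup (α / 2 + 1 / 4) (β / 2 + 1 / 4) p := by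
  have hc : Continuous fun x : ℝ =>
      (1 - x) ^ (α / 2 + 1 / 4) * (1 + x) ^ (β / 2 + 1 / 4) * |p.eval x| :=
    (((continuous_const.sub continuous_id).rpow_const fun _ => Or.inr (by linarith)).mul
      ((continuous_const.add continuous_id).rpow_const fun _ => Or.inr (by linarith))).mul
      p.continuous.abs
  refine le_csSup (isCompact_Icc.image hc).bddAbove
    ⟨cos θ, ⟨neg_one_le_cos θ, cos_le_one θ⟩, ?_⟩
  have h1 : 0 ≤ 1 - cos θ := by linarith [cos_le_one θ]
  have h2 : 0 ≤ 1 + cos θ := by linarith [neg_one_le_cos θ]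
  rw [wave, waveWeight, abs_mul, abs_of_nonneg (by positivity)]

theorem jacobiSup_le {M : ℝ} (hM : ∀ t ∈ Icc 0 π, |wave α β p t| ≤ M) :
    jacobiSup (α / 2 + 1 / 4) (β / 2 + 1 / 4) p ≤ M := by
  refine csSup_le ((nonempty_Icc.2 (by norm_num)).image _) ?_
  rintro _ ⟨x, hx, rfl⟩
  have h1 : 0 ≤ 1 - x := by linarith [hx.2]
  have h2 : 0 ≤ 1 + x := by linarith [hx.1]
  have h := hM (arccos x) ⟨arccos_nonneg x, arccos_le_pi x⟩
  rwa [wave, waveWeight, abs_mul, cos_arccos hx.1 hx.2, abs_of_nonneg (by positivity)] at h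

theorem IsMonicJacobi.jacobiSup_sq_bounds {n : ℕ} (hα : α ∈ Icc (-(1 : ℝ) / 2) (1 / 2))
    (hβ : β ∈ Icc (-(1 : ℝ) / 2) (1 / 2)) (hn : 1 ≤ n) (hp : IsMonicJacobi α β n p) :
    π * jacobiSup (α / 2 + 1 / 4) (β / 2 + 1 / 4) p ^ 2 ≤ 2 * jacobiNormSq α β n ∧
    2 * (n : ℝ) ^ 2 * jacobiNormSq α β n ≤
      π * ((n : ℝ) ^ 2 + 9 / 2) * jacobiSup (α / 2 + 1 / 4) (β / 2 + 1 / 4) p ^ 2 := by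
  have hn' : (1 : ℝ) ≤ n := by exact_mod_cast hn
  have hα1 : -1 < α := by linarith [hα.1]
  have hβ1 : -1 < β := by linarith [hβ.1]
  have hsol := hp.isJacobiSolution hα1 hβ1
  have hH := hp.jacobiInt_mul_self hα1 hβ1 (by linarith [hα.1, hβ.1])
  rw [← integral_wave_sq_eq_jacobiInt hα hβ] at hH
  set s := jacobiSup (α / 2 + 1 / 4) (β / 2 + 1 / 4) p
  obtain ⟨N2, hN⟩ : ∃ N2 : ℝ, N2 = n * (n + α + β + 1) + ((α + β + 1) / 2) ^ 2 := ⟨_, rfl⟩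
  have hNn : (n : ℝ) ^ 2 ≤ N2 := by
    rw [hN]
    nlinarith [hα.1, hβ.1, sq_nonneg ((α + β + 1) / 2)]
  have hN0 : 0 < N2 := by nlinarith
  have hw : ∀ t, |wave α β p t| ≤ s := fun t => abs_wave_le_jacobiSup hα.1 hβ.1
  have hs0 : 0 ≤ s := (abs_nonneg _).trans (hw 0)
  have hupper : π * s ^ 2 ≤ 2 * jacobiNormSq α β n := by
    have hle : s ≤ √(2 * jacobiNormSq α β n / π) := jacobiSup_le fun t ht => by
      refine abs_le_sqrt ?_
      rw [le_div_iff₀ pi_pos, ← hH, mul_comm]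
      exact pi_mul_wave_sq_le hα hβ hsol hN hN0 ht
    have hnonneg : 0 ≤ jacobiNormSq α β n := by
      rw [← hH]
      exact intervalIntegral.integral_nonneg pi_pos.le fun t _ => sq_nonneg _
    have := pow_le_pow_left₀ hs0 hle 2
    rwa [sq_sqrt (by positivity), le_div_iff₀ pi_pos, mul_comm] at this
  refine ⟨hupper, ?_⟩
  have h := integral_wave_sq_le_of_abs_wave_le hα hβ hsol hN hN0 hw
  rw [hH] at h
  nlinarith

end JacobiWave

theorem jacobi_weighted_sup_lim_eq_sup
    (α β : ℝ) (hα : α ∈ Set.Icc (-(1 : ℝ) / 2) (1 / 2))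
    (hβ : β ∈ Set.Icc (-(1 : ℝ) / 2) (1 / 2))
    (P : ℕ → Polynomial ℝ) (hP : ∀ n : ℕ, 1 ≤ n → IsMonicJacobi α β n (P n))
    (a : ℕ → ℝ)
    (ha : ∀ n : ℕ, a n = 2 ^ n * jacobiSup (α / 2 + 1 / 4) (β / 2 + 1 / 4) (P n)) :
    Tendsto a atTop
        (nhds ((2 : ℝ) ^ (1 - (α / 2 + 1 / 4) - (β / 2 + 1 / 4)))) ∧
      (⨆ n : (Set.Ici 1 : Set ℕ), a n.1) =
        (2 : ℝ) ^ (1 - (α / 2 + 1 / 4) - (β / 2 + 1 / 4)) := by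
  have hπ := Real.pi_pos
  set A : ℝ := (2 : ℝ) ^ (1 - (α / 2 + 1 / 4) - (β / 2 + 1 / 4)) with hA
  have hA0 : 0 < A := by positivity
  have hAsq : A ^ 2 = 2 * 2 ^ (-(α + β)) := by
    have h := Real.rpow_add (two_pos (α := ℝ)) 1 (-(α + β))
    rw [Real.rpow_one] at h
    rw [hA, ← Real.rpow_natCast, ← Real.rpow_mul two_pos.le, ← h]
    congr 1
    push_cast
    ring
  have ha0 : ∀ n, 0 ≤ a n := fun n => by
    rw [ha]
    have := (abs_nonneg _).trans (abs_wave_le_jacobiSup (p := P n) (θ := 0) hα.1 hβ.1)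
    positivity
  have hasq : ∀ n, a n ^ 2 = 4 ^ n * jacobiSup (α / 2 + 1 / 4) (β / 2 + 1 / 4) (P n) ^ 2 :=
    fun n => by
      rw [ha, mul_pow, ← pow_mul, mul_comm n 2, pow_mul]
      norm_num
  have hup : ∀ n, 1 ≤ n → a n ^ 2 ≤ 2 / Real.pi * (4 ^ n * jacobiNormSq α β n) := fun n hn => by
    have h := ((hP n hn).jacobiSup_sq_bounds hα hβ hn).1
    rw [hasq, div_mul_eq_mul_div, le_div_iff₀ hπ]
    nlinarith [mul_le_mul_of_nonneg_left h (pow_nonneg (zero_le_four (α := ℝ)) n)]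
  have hlow : ∀ n : ℕ, 1 ≤ n →
      (n : ℝ) ^ 2 / ((n : ℝ) ^ 2 + 9 / 2) * (2 / Real.pi * (4 ^ n * jacobiNormSq α β n)) ≤
        a n ^ 2 := fun n hn => by
    have h := ((hP n hn).jacobiSup_sq_bounds hα hβ hn).2
    rw [hasq, div_mul_eq_mul_div, div_le_iff₀ (by positivity), div_mul_eq_mul_div, mul_div_assoc',
      div_le_iff₀ hπ]
    nlinarith [mul_le_mul_of_nonneg_left h (pow_nonneg (zero_le_four (α := ℝ)) n)]
  have hle : ∀ n, 1 ≤ n → a n ≤ A := fun n hn => by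
    refine le_of_sq_le_sq ?_ hA0.le
    refine (hup n hn).trans ?_
    rw [hAsq, div_mul_eq_mul_div, div_le_iff₀ hπ]
    nlinarith [four_pow_mul_jacobiNormSq_le hα hβ hn]
  have hB : Tendsto (fun n : ℕ => 2 / Real.pi * ((4 : ℝ) ^ n * jacobiNormSq α β n)) atTop
      (nhds (A ^ 2)) := by
    have h := (tendsto_four_pow_mul_jacobiNormSq (by linarith [hα.1]) (by linarith [hβ.1])
      (by linarith [hα.1, hβ.1] : -1 ≤ α + β)).const_mul (2 / Real.pi)
    convert h using 2
    rw [hAsq]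
    field_simp
  have hratio : Tendsto (fun n : ℕ => (n : ℝ) ^ 2 / ((n : ℝ) ^ 2 + 9 / 2)) atTop (nhds 1) := by
    have hn2 : Tendsto (fun n : ℕ => (n : ℝ) ^ 2 + 9 / 2) atTop atTop :=
      tendsto_atTop_add_const_right _ _
        ((tendsto_pow_atTop two_ne_zero).comp tendsto_natCast_atTop_atTop)
    have h := (hn2.const_div_atTop (9 / 2)).const_sub 1
    rw [sub_zero] at h
    refine h.congr fun n => ?_
    field_simp
    ring
  have hlim2 : Tendsto (fun n => a n ^ 2) atTop (nhds (A ^ 2)) := by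
    have h := hratio.mul hB
    rw [one_mul] at h
    refine tendsto_of_tendsto_of_tendsto_of_le_of_le' h hB ?_ ?_
    · filter_upwards [eventually_ge_atTop 1] with n hn using hlow n hn
    · filter_upwards [eventually_ge_atTop 1] with n hn using hup n hn
  have hlim : Tendsto a atTop (nhds A) := by
    have h := hlim2.sqrt
    rw [Real.sqrt_sq hA0.le] at h
    exact h.congr fun n => Real.sqrt_sq (ha0 n)
  refine ⟨hlim, le_antisymm ?_ ?_⟩
  · have : Nonempty (Set.Ici 1 : Set ℕ) := ⟨⟨1, Set.mem_Ici.2 le_rfl⟩⟩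
    exact ciSup_le fun n => hle n.1 n.2
  · have hbdd : BddAbove (Set.range fun n : (Set.Ici 1 : Set ℕ) => a n.1) :=
      ⟨A, by rintro _ ⟨n, rfl⟩; exact hle n.1 n.2⟩
    refine le_of_tendsto hlim ?_
    filter_upwards [eventually_ge_atTop 1] with n hn
    exact le_ciSup hbdd ⟨n, hn⟩
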